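/- arXiv:1807.10155 — 5 statements merged into one kernel-verified Lean document; each statement's English description precedes it below -/
import Mathlib

section
/- Let (X,T) be a topological dynamical system, let x ∈ X, and let M ⊆ X be a nonempty closed T-invariant set such that the subsystem (M, T|_M) is minimal and weakly mixing. If x is proximal to some point of M, then the set {y ∈ M : (x,y) is proximal} is dense in M. -/
open Set Function Filter Topology

structure TDS where
  carrier : Type
  [ms : MetricSpace carrier]
  [cs : CompactSpace carrier]
  map : carrier → carrier
  cont : Continuous map
  surj : Function.Surjective map

attribute [instance] TDS.ms TDS.cs

def orbit {X : Type*} (T : X → X) (x : X) : Set X :=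
  Set.range fun n : ℕ => T^[n] x

def IsMinimalSys {Y : Type*} [TopologicalSpace Y] (S : Y → Y) : Prop :=
  ∀ y : Y, Dense (orbit S y)

def IsTransitiveSys {X : Type*} [TopologicalSpace X] (T : X → X) : Prop :=
  ∀ U V : Set X, IsOpen U → IsOpen V → U.Nonempty → V.Nonempty →
    {n : ℕ | (U ∩ T^[n] ⁻¹' V).Nonempty}.Infinite

def IsWeaklyMixingSys {X : Type*} [TopologicalSpace X] (T : X → X) : Prop :=
  IsTransitiveSys fun p : X × X => (T p.1, T p.2)

def IsJoining {X Y : Type*} [TopologicalSpace X] [TopologicalSpace Y]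
    (T : X → X) (S : Y → Y) (J : Set (X × Y)) : Prop :=
  J.Nonempty ∧ IsClosed J ∧ (∀ p ∈ J, (T p.1, S p.2) ∈ J) ∧
    Prod.fst '' J = Set.univ ∧ Prod.snd '' J = Set.univ

def DisjointSys {X Y : Type*} [TopologicalSpace X] [TopologicalSpace Y]
    (T : X → X) (S : Y → Y) : Prop :=
  ∀ J : Set (X × Y), IsJoining T S J → J = Set.univ

def Syndetic (A : Set ℕ) : Prop :=
  ∃ N : ℕ, ∀ i : ℕ, ∃ j ≤ N, i + j ∈ A

def Thick (A : Set ℕ) : Prop :=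
  ∀ L : ℕ, ∃ n : ℕ, ∀ j ≤ L, n + j ∈ A

def IsMinimalPoint {X : Type*} [TopologicalSpace X] (T : X → X) (x : X) : Prop :=
  ∀ y ∈ closure (orbit T x), closure (orbit T x) ⊆ closure (orbit T y)

def Proximal {X : Type*} [MetricSpace X] (T : X → X) (x y : X) : Prop :=
  ∃ u : ℕ → ℕ, Filter.Tendsto (fun i => dist (T^[u i] x) (T^[u i] y)) Filter.atTop (nhds 0)

def IsDistalPoint {X : Type*} [MetricSpace X] (T : X → X) (x : X) : Prop :=
  ∀ y ∈ closure (orbit T x), Proximal T x y → y = x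

def DynSyndetic (B : Set ℕ) : Prop :=
  ∃ 𝒴 : TDS, IsMinimalSys 𝒴.map ∧
    ∃ (y : 𝒴.carrier) (V : Set 𝒴.carrier),
      IsOpen V ∧ y ∈ V ∧ {n : ℕ | 𝒴.map^[n] y ∈ V} ⊆ B

def CentralSet (S : Set ℕ) : Prop :=
  ∃ 𝒵 : TDS, ∃ (z w : 𝒵.carrier) (W : Set 𝒵.carrier),
    IsMinimalPoint 𝒵.map w ∧ Proximal 𝒵.map z w ∧ IsOpen W ∧ w ∈ W ∧
    {n : ℕ | 𝒵.map^[n] z ∈ W} ⊆ S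

def CStarSet (A : Set ℕ) : Prop :=
  ∀ S : Set ℕ, CentralSet S → (A ∩ S).Nonempty

/-- In a compact minimal system the return times to a nonempty open set are syndetic, uniformly
in the starting point. -/
theorem IsMinimalSys.exists_uniform_hitting_time {Y : Type*} [TopologicalSpace Y] [CompactSpace Y]
    {S : Y → Y} (hS : Continuous S) (hmin : IsMinimalSys S) {V : Set Y} (hV : IsOpen V)
    (hne : V.Nonempty) : ∃ N : ℕ, ∀ y : Y, ∃ j ≤ N, S^[j] y ∈ V := by
  obtain ⟨t, ht⟩ := isCompact_univ.elim_finite_subcover (fun n : ℕ => S^[n] ⁻¹' V)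
    (fun n => hV.preimage (hS.iterate n)) (fun y _ => by
      obtain ⟨_, hz, n, rfl⟩ := (hmin y).inter_open_nonempty V hV hne
      exact mem_iUnion.2 ⟨n, hz⟩)
  refine ⟨t.sup id, fun y => ?_⟩
  obtain ⟨j, hj, hy⟩ := mem_iUnion₂.1 (ht (mem_univ y))
  exact ⟨j, Finset.le_sup (f := id) hj, hy⟩

theorem iterate_prodMap_self {Y : Type*} (S : Y → Y) (n : ℕ) (p : Y × Y) :
    (fun p : Y × Y => (S p.1, S p.2))^[n] p = (S^[n] p.1, S^[n] p.2) := by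
  induction n generalizing p with
  | zero => rfl
  | succ n ih => simp [ih]

/-- Furstenberg intersection lemma: in a weakly mixing system, the intersection of two sets of
transfer times contains a third one. -/
theorem IsWeaklyMixingSys.exists_transfer_subset {Y : Type*} [TopologicalSpace Y]
    {S : Y → Y} (hS : Continuous S) (hwm : IsWeaklyMixingSys S) {U V U' V' : Set Y}
    (hU : IsOpen U) (hV : IsOpen V) (hU' : IsOpen U') (hV' : IsOpen V')
    (hUn : U.Nonempty) (hVn : V.Nonempty) (hUn' : U'.Nonempty) (hVn' : V'.Nonempty) :
    ∃ A B : Set Y, IsOpen A ∧ IsOpen B ∧ A.Nonempty ∧ B.Nonempty ∧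
      ∀ n, (A ∩ S^[n] ⁻¹' B).Nonempty →
        (U ∩ S^[n] ⁻¹' V).Nonempty ∧ (U' ∩ S^[n] ⁻¹' V').Nonempty := by
  obtain ⟨k, p, ⟨hp₁, hp₂⟩, hk⟩ :=
    (hwm (U ×ˢ V) (U' ×ˢ V') (hU.prod hV) (hU'.prod hV') (hUn.prod hVn)
      (hUn'.prod hVn')).nonempty
  rw [mem_preimage, iterate_prodMap_self] at hk
  refine ⟨U ∩ S^[k] ⁻¹' U', V ∩ S^[k] ⁻¹' V', hU.inter (hU'.preimage (hS.iterate k)),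
    hV.inter (hV'.preimage (hS.iterate k)), ⟨p.1, hp₁, hk.1⟩, ⟨p.2, hp₂, hk.2⟩, ?_⟩
  rintro n ⟨y, ⟨hy, hy'⟩, hny, hny'⟩
  refine ⟨⟨y, hy, hny⟩, ⟨S^[k] y, hy', ?_⟩⟩
  simpa only [mem_preimage, ← iterate_add_apply, add_comm] using hny'

theorem IsWeaklyMixingSys.exists_transfer_subset_of_finite {Y ι : Type*} [TopologicalSpace Y]
    {S : Y → Y} (hS : Continuous S) (hwm : IsWeaklyMixingSys S) {U : Set Y} (hU : IsOpen U)
    (hUn : U.Nonempty) {V : ι → Set Y} (hV : ∀ i, IsOpen (V i)) (hVn : ∀ i, (V i).Nonempty)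
    {t : Set ι} (ht : t.Finite) :
    ∃ A B : Set Y, IsOpen A ∧ IsOpen B ∧ A.Nonempty ∧ B.Nonempty ∧
      ∀ n, (A ∩ S^[n] ⁻¹' B).Nonempty → ∀ i ∈ t, (U ∩ S^[n] ⁻¹' V i).Nonempty := by
  induction t, ht using Set.Finite.induction_on with
  | empty => exact ⟨U, U, hU, hU, hUn, hUn, by simp⟩
  | insert _ _ ih =>
    rename_i i t _ _
    obtain ⟨A, B, hA, hB, hAn, hBn, h⟩ := ih
    obtain ⟨A', B', hA', hB', hAn', hBn', h'⟩ := hwm.exists_transfer_subset hS hU (hV i) hA hB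
      hUn (hVn i) hAn hBn
    refine ⟨A', B', hA', hB', hAn', hBn', fun n hn => ?_⟩
    rintro j (rfl | hj)
    · exact (h' n hn).1
    · exact h n (h' n hn).2 j hj

theorem IsMinimalSys.exists_transfer_of_finite {Y ι : Type*} [TopologicalSpace Y]
    [CompactSpace Y] {S : Y → Y} (hS : Continuous S) (hmin : IsMinimalSys S)
    (hwm : IsWeaklyMixingSys S) {U : Set Y} (hU : IsOpen U) (hUn : U.Nonempty) {V : ι → Set Y}
    (hV : ∀ i, IsOpen (V i)) (hVn : ∀ i, (V i).Nonempty) {t : Set ι} (ht : t.Finite) :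
    Syndetic {n | ∀ i ∈ t, (U ∩ S^[n] ⁻¹' V i).Nonempty} := by
  obtain ⟨A, B, -, hB, ⟨a, ha⟩, hBn, h⟩ :=
    hwm.exists_transfer_subset_of_finite hS hU hUn hV hVn ht
  obtain ⟨N, hN⟩ := hmin.exists_uniform_hitting_time hS hB hBn
  refine ⟨N, fun m => ?_⟩
  obtain ⟨j, hj, hy⟩ := hN (S^[m] a)
  refine ⟨j, hj, h _ ⟨a, ha, ?_⟩⟩
  rwa [mem_preimage, add_comm, iterate_add_apply]

theorem Syndetic.inter_nonempty {A B : Set ℕ} (hA : Syndetic A) (hB : Thick B) :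
    (A ∩ B).Nonempty := by
  obtain ⟨N, hN⟩ := hA
  obtain ⟨n, hn⟩ := hB N
  obtain ⟨j, hj, h⟩ := hN n
  exact ⟨n + j, h, hn j hj⟩

theorem Proximal.thick {X : Type*} [MetricSpace X] [CompactSpace X] {T : X → X}
    (hT : Continuous T) {x z : X} (h : Proximal T x z) {ε : ℝ} (hε : 0 < ε) :
    Thick {n | dist (T^[n] x) (T^[n] z) < ε} := by
  intro L
  have hclose : ∀ᶠ p in uniformity X, ∀ j ∈ Iic L, dist (T^[j] p.1) (T^[j] p.2) < ε :=
    (eventually_all_finite (finite_Iic L)).2 fun j _ =>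
      (CompactSpace.uniformContinuous_of_continuous (hT.iterate j)).eventually
        (Metric.dist_mem_uniformity hε)
  obtain ⟨u, hu⟩ := h
  obtain ⟨i, hi⟩ := ((tendsto_uniformity_iff_dist_tendsto_zero
    (f := fun i => (T^[u i] x, T^[u i] z))).2 hu |>.eventually hclose).exists
  refine ⟨u i, fun j hj => ?_⟩
  simpa only [mem_ofPred_eq, add_comm, iterate_add_apply] using hi j hj

theorem proximal_of_forall_exists_dist_lt {X : Type*} [MetricSpace X] {T : X → X} {x y : X}
    (h : ∀ k : ℕ, ∃ n, dist (T^[n] x) (T^[n] y) < 1 / ((k : ℝ) + 1)) : Proximal T x y := by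
  choose u hu using h
  exact ⟨u, squeeze_zero (fun _ => dist_nonneg) (fun k => (hu k).le)
    tendsto_one_div_add_atTop_nhds_zero_nat⟩

theorem stmt_13 {X : Type} [MetricSpace X] [CompactSpace X] (T : X → X)
    (hTc : Continuous T) (hTs : Function.Surjective T) (x : X) (M : Set X)
    (hMne : M.Nonempty) (hMcl : IsClosed M) (hMinv : Set.MapsTo T M M)
    (hmin : IsMinimalSys (Set.MapsTo.restrict T M M hMinv))
    (hwm : IsWeaklyMixingSys (Set.MapsTo.restrict T M M hMinv))
    (hprox : ∃ z ∈ M, Proximal T x z) :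
    M ⊆ closure {y : X | y ∈ M ∧ Proximal T x y} := by
  have hSc : Continuous (MapsTo.restrict T M M hMinv) := hTc.restrict hMinv
  have : CompactSpace M := isCompact_iff_compactSpace.1 hMcl.isCompact
  have hit (n : ℕ) (y : M) : (((MapsTo.restrict T M M hMinv)^[n] y : M) : X) = T^[n] y := by
    rw [hMinv.iterate_restrict]
    rfl
  obtain ⟨z, hzM, hz⟩ := hprox
  let G (k : ℕ) : Set M := {y | ∃ n, dist (T^[n] x) (T^[n] (y : X)) < 1 / ((k : ℝ) + 1)}
  have hGo (k : ℕ) : IsOpen (G k) := by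
    simp only [G, ofPred_exists]
    exact isOpen_iUnion fun n => isOpen_lt
      (continuous_const.dist ((hTc.iterate n).comp continuous_subtype_val)) continuous_const
  have hGd (k : ℕ) : Dense (G k) := by
    rw [dense_iff_inter_open]
    intro U hU hUn
    have hε : (0 : ℝ) < 1 / ((k : ℝ) + 1) / 3 := by positivity
    set ε : ℝ := 1 / ((k : ℝ) + 1) / 3 with hεdef
    obtain ⟨t, -, ht, hcov⟩ := (isCompact_univ (X := M)).finite_cover_balls hε
    obtain ⟨n, hn, hxz⟩ := (hmin.exists_transfer_of_finite hSc hwm hU hUn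
      (V := fun c => Metric.ball c ε) (fun _ => Metric.isOpen_ball)
      (fun _ => Metric.nonempty_ball.2 hε) ht).inter_nonempty (hz.thick hTc hε)
    obtain ⟨c, hc, hzc⟩ := mem_iUnion₂.1
      (hcov (mem_univ ((MapsTo.restrict T M M hMinv)^[n] ⟨z, hzM⟩)))
    obtain ⟨y, hyU, hyc⟩ := hn c hc
    refine ⟨y, hyU, n, ?_⟩
    rw [Metric.mem_ball, Subtype.dist_eq, hit] at hzc
    rw [mem_preimage, Metric.mem_ball, Subtype.dist_eq, hit] at hyc
    rw [mem_ofPred_eq] at hxz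
    have h₁ := dist_triangle (T^[n] x) (T^[n] z) (T^[n] (y : X))
    have h₂ := dist_triangle_right (T^[n] z) (T^[n] (y : X)) (c : X)
    linarith
  intro m hm
  refine closure_mono ?_ (image_closure_subset_closure_image continuous_subtype_val
    ⟨⟨m, hm⟩, dense_iInter_of_isOpen hGo hGd ⟨m, hm⟩, rfl⟩)
  rintro _ ⟨y, hy, rfl⟩
  exact ⟨y.2, proximal_of_forall_exists_dist_lt fun k => mem_iInter.1 hy k⟩
end

section
/- Let (X,T) be a transitive topological dynamical system that is disjoint from every minimal topological dynamical system. Then for every n ∈ ℕ the n-fold product system (X^n, T^{(n)}), where T^{(n)} = T × ⋯ × T (n times), is also disjoint from every minimal topological dynamical system. -/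
open Set Function Filter Topology

/-- In a transitive system, finitely many nonempty open sets can be pulled back by suitable
iterates so that they have a common point. -/
lemma IsTransitiveSys.exists_iterate_mem {X ι : Type*} [TopologicalSpace X] [Nonempty X]
    {T : X → X} (hT : Continuous T) (htr : IsTransitiveSys T) (U : ι → Set X)
    (hU : ∀ i, IsOpen (U i)) (hne : ∀ i, (U i).Nonempty) (s : Finset ι) :
    ∃ m : ι → ℕ, ∃ z : X, ∀ i ∈ s, T^[m i] z ∈ U i := by
  classical
  induction s using Finset.induction_on with
  | empty => exact ⟨fun _ => 0, Classical.arbitrary X, by simp⟩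
  | insert a s ha ih =>
    obtain ⟨m, z, hz⟩ := ih
    have hopen : IsOpen (⋂ i ∈ s, T^[m i] ⁻¹' U i) :=
      isOpen_biInter_finset fun i _ => (hU i).preimage (hT.iterate (m i))
    obtain ⟨k, w, hw, hwk⟩ := (htr _ (U a) hopen (hU a) ⟨z, by simpa using hz⟩ (hne a)).nonempty
    refine ⟨Function.update m a k, w, fun i hi => ?_⟩
    by_cases h : i = a
    · subst h
      simpa using hwk
    · have his : i ∈ s := (Finset.mem_insert.mp hi).resolve_left h
      rw [Function.update_of_ne h]
      simp only [Set.mem_iInter] at hw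
      exact hw i his

/-- In a transitive system, the tuples of points lying on a common forward orbit are dense in
every finite power. -/
lemma IsTransitiveSys.dense_range_iterate {X ι : Type*} [TopologicalSpace X] [Nonempty X]
    [Finite ι] {T : X → X} (hT : Continuous T) (htr : IsTransitiveSys T) :
    Dense (Set.range fun q : (ι → ℕ) × X => fun i => T^[q.1 i] q.2) := by
  have := Fintype.ofFinite ι
  intro x
  rw [mem_closure_iff_nhds]
  intro O hO
  obtain ⟨U, hU, hUO⟩ := (isOpen_pi_iff'.mp isOpen_interior) x (mem_interior_iff_mem_nhds.mpr hO)
  obtain ⟨m, z, hz⟩ := htr.exists_iterate_mem hT U (fun i => (hU i).1) (fun i => ⟨x i, (hU i).2⟩)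
    Finset.univ
  exact ⟨_, interior_subset (hUO fun i _ => hz i (Finset.mem_univ i)), ⟨(m, z), rfl⟩⟩

/-- A nonempty closed forward-invariant subset of a minimal system is the whole space. -/
lemma IsMinimalSys.eq_univ_of_isClosed {Y : Type*} [TopologicalSpace Y] {S : Y → Y}
    (hS : IsMinimalSys S) {C : Set Y} (hC : IsClosed C) (hne : C.Nonempty)
    (hinv : Set.MapsTo S C C) : C = Set.univ := by
  obtain ⟨y, hy⟩ := hne
  have hsub : orbit S y ⊆ C := by
    rintro _ ⟨k, rfl⟩
    exact hinv.iterate k hy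
  exact Set.univ_subset_iff.mp ((hS y).closure_eq ▸ closure_minimal hsub hC)

theorem stmt_15 {X : Type} [MetricSpace X] [CompactSpace X] (T : X → X)
    (hTc : Continuous T) (hTs : Function.Surjective T) (hTtr : IsTransitiveSys T)
    (hdisj : ∀ 𝒴 : TDS, IsMinimalSys 𝒴.map → DisjointSys T 𝒴.map)
    (n : ℕ) (hn : 0 < n) :
    ∀ 𝒴 : TDS, IsMinimalSys 𝒴.map →
      DisjointSys (fun x : Fin n → X => fun i => T (x i)) 𝒴.map := by
  rintro 𝒴 hmin J ⟨⟨p, hp⟩, hclosed, hinv, hfst, -⟩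
  have : Nonempty X := ⟨p.1 ⟨0, hn⟩⟩
  have horbit : ∀ (m : Fin n → ℕ) (z : X) (y : 𝒴.carrier), ((fun i => T^[m i] z), y) ∈ J := by
    intro m
    set g : X × 𝒴.carrier → (Fin n → X) × 𝒴.carrier :=
      fun q => ((fun i => T^[m i] q.1), q.2) with hg
    have hgc : Continuous g :=
      (continuous_pi fun i => (hTc.iterate (m i)).comp continuous_fst).prodMk continuous_snd
    have hJc : IsClosed (g ⁻¹' J) := hclosed.preimage hgc
    have hJinv : ∀ q ∈ g ⁻¹' J, (T q.1, 𝒴.map q.2) ∈ g ⁻¹' J := by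
      intro q hq
      simpa only [hg, Set.mem_preimage, ← Function.iterate_succ_apply,
        Function.iterate_succ_apply'] using hinv _ hq
    have hJfst : Prod.fst '' (g ⁻¹' J) = Set.univ := by
      refine Set.eq_univ_of_forall fun z => ?_
      obtain ⟨⟨x, y⟩, hxy, hx⟩ : (fun i => T^[m i] z) ∈ Prod.fst '' J := hfst ▸ Set.mem_univ _
      obtain rfl : x = fun i => T^[m i] z := hx
      exact ⟨(z, y), hxy, rfl⟩
    have hJne : (g ⁻¹' J).Nonempty := by
      rw [← Set.image_nonempty (f := Prod.fst), hJfst]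
      exact Set.univ_nonempty
    have hJsnd : Prod.snd '' (g ⁻¹' J) = Set.univ := by
      refine hmin.eq_univ_of_isClosed (hJc.isCompact.image continuous_snd).isClosed
        (hJne.image _) ?_
      rintro _ ⟨q, hq, rfl⟩
      exact ⟨_, hJinv q hq, rfl⟩
    have hall := hdisj 𝒴 hmin _ ⟨hJne, hJc, hJinv, hJfst, hJsnd⟩
    intro z y
    have hzy : (z, y) ∈ g ⁻¹' J := hall ▸ Set.mem_univ _
    exact hzy
  refine Set.eq_univ_of_forall fun ⟨x, y⟩ => ?_
  have hslice : IsClosed {x : Fin n → X | (x, y) ∈ J} :=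
    hclosed.preimage (Continuous.prodMk_left y)
  have hsub : (Set.range fun q : (Fin n → ℕ) × X => fun i => T^[q.1 i] q.2) ⊆
      {x : Fin n → X | (x, y) ∈ J} := by
    rintro _ ⟨⟨m, z⟩, rfl⟩
    exact horbit m z y
  exact closure_minimal hsub hslice (hTtr.dense_range_iterate hTc x)
end

section
/- Let (X,T) be a transitive topological dynamical system. Then (X,T) is disjoint from every minimal topological dynamical system if and only if the hyperspace system (K(X), T_K) is disjoint from every minimal topological dynamical system. -/
open Set Function Filter Topology

noncomputable def hyperMap {X : Type*} [MetricSpace X] (T : X → X) (hc : Continuous T) :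
    TopologicalSpace.NonemptyCompacts X → TopologicalSpace.NonemptyCompacts X :=
  fun A => ⟨⟨T '' (A : Set X), A.isCompact.image hc⟩, A.nonempty.image T⟩

/-- Disjointness from every minimal system. -/
def DisjointFromMinimal {G : Type} [TopologicalSpace G] (R : G → G) : Prop :=
  ∀ 𝒴 : TDS, IsMinimalSys 𝒴.map → DisjointSys R 𝒴.map

namespace IsMinimalSys

variable {Y : Type*} [TopologicalSpace Y] {S : Y → Y}

theorem eq_univ_of_mapsTo (hS : IsMinimalSys S) {C : Set Y} (hC : IsClosed C)
    (hne : C.Nonempty) (h : MapsTo S C C) : C = univ := by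
  obtain ⟨y, hy⟩ := hne
  have horb : orbit S y ⊆ C := by
    rintro _ ⟨n, rfl⟩
    exact h.iterate n hy
  have := closure_minimal horb hC
  rwa [(hS y).closure_eq, univ_subset_iff] at this

theorem exists_iterate_mem (hS : IsMinimalSys S) {V : Set Y} (hV : IsOpen V)
    (hne : V.Nonempty) (y : Y) : ∃ n, S^[n] y ∈ V := by
  obtain ⟨_, hv, n, rfl⟩ := (hS y).inter_open_nonempty V hV hne
  exact ⟨n, hv⟩

theorem surjective [CompactSpace Y] [T2Space Y] (hS : IsMinimalSys S) (hc : Continuous S) :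
    Surjective S := by
  rcases isEmpty_or_nonempty Y with h | h
  · exact fun y => (h.false y).elim
  · rw [← range_eq_univ]
    exact hS.eq_univ_of_mapsTo (isCompact_range hc).isClosed (range_nonempty S)
      fun y _ => mem_range_self y

end IsMinimalSys

theorem DisjointFromMinimal.disjointSys {G : Type} [TopologicalSpace G] {R : G → G}
    (h : DisjointFromMinimal R) {Y : Type} [tY : TopologicalSpace Y] [CompactSpace Y]
    [TopologicalSpace.MetrizableSpace Y] {S : Y → Y} (hc : Continuous S)
    (hS : IsMinimalSys S) : DisjointSys R S := by
  have hsurj := hS.surjective hc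
  let _ := TopologicalSpace.metrizableSpaceMetric Y
  exact h ⟨Y, S, hc, hsurj⟩ hS

theorem DisjointSys.eq_univ_of_forall_exists {G Y : Type*} [TopologicalSpace G] [CompactSpace G]
    [TopologicalSpace Y] [CompactSpace Y] [T2Space Y]
    {R : G → G} {S : Y → Y} (h : DisjointSys R S) (hS : IsMinimalSys S)
    {J : Set (G × Y)} (hJ : IsClosed J) (hinv : ∀ p ∈ J, (R p.1, S p.2) ∈ J)
    (hfst : ∀ g, ∃ y, (g, y) ∈ J) : J = univ := by
  rcases isEmpty_or_nonempty G with hG | ⟨⟨g₀⟩⟩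
  · exact eq_univ_of_forall fun p => (hG.false p.1).elim
  obtain ⟨y₀, hy₀⟩ := hfst g₀
  refine h J ⟨⟨_, hy₀⟩, hJ, hinv, ?_, ?_⟩
  · exact eq_univ_of_forall fun g => (hfst g).elim fun y hy => ⟨_, hy, rfl⟩
  · have hcl : IsClosed (Prod.snd '' J) := isClosedMap_snd_of_compactSpace _ hJ
    refine hS.eq_univ_of_mapsTo hcl ⟨_, _, hy₀, rfl⟩ ?_
    rintro _ ⟨p, hp, rfl⟩
    exact ⟨_, hinv p hp, rfl⟩

/-- The first coordinate can be chosen in a nonempty open set so that it enters `U` simultaneously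
with any point of `Y` entering `V`, within bounded time. -/
theorem DisjointSys.exists_simultaneous {E Y : Type*} [TopologicalSpace E] [CompactSpace E]
    [TopologicalSpace Y] [CompactSpace Y] [T2Space Y] {T : E → E} {S : Y → Y}
    (h : DisjointSys T S) (hT : Continuous T) (hSc : Continuous S) (hS : IsMinimalSys S)
    {U : Set E} {V : Set Y} (hU : IsOpen U) (hV : IsOpen V) (hUne : U.Nonempty)
    (hVne : V.Nonempty) :
    ∃ N : ℕ, ∃ O : Set E, IsOpen O ∧ O.Nonempty ∧
      ∀ e ∈ O, ∀ y, ∃ n ≤ N, T^[n] e ∈ U ∧ S^[n] y ∈ V := by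
  obtain ⟨e₀, he₀⟩ : ∃ e, ∀ y, ∃ n, T^[n] e ∈ U ∧ S^[n] y ∈ V := by
    by_contra! hcon
    have hJ : {p : E × Y | ∀ n, T^[n] p.1 ∈ U → S^[n] p.2 ∉ V} = univ := by
      refine h.eq_univ_of_forall_exists hS ?_ (fun p hp n => ?_) hcon
      · simp only [ofPred_forall]
        refine isClosed_iInter fun n => ?_
        have h1 : IsOpen {p : E × Y | T^[n] p.1 ∈ U} :=
          hU.preimage ((hT.iterate n).comp continuous_fst)
        have h2 : IsOpen {p : E × Y | S^[n] p.2 ∈ V} :=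
          hV.preimage ((hSc.iterate n).comp continuous_snd)
        exact isClosed_imp h1 h2.isClosed_compl
      · simpa only [← iterate_succ_apply] using hp (n + 1)
    obtain ⟨u, hu⟩ := hUne
    obtain ⟨v, hv⟩ := hVne
    have : (u, v) ∈ {p : E × Y | ∀ n, T^[n] p.1 ∈ U → S^[n] p.2 ∉ V} := hJ ▸ mem_univ _
    exact this 0 hu hv
  obtain ⟨t, ht⟩ := (isCompact_univ (X := Y)).elim_finite_subcover
    (fun n : {n // T^[n] e₀ ∈ U} => S^[n.1] ⁻¹' V) (fun n => hV.preimage (hSc.iterate _))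
    (fun y _ => by
      obtain ⟨n, hn, hy⟩ := he₀ y
      exact mem_iUnion.2 ⟨⟨n, hn⟩, hy⟩)
  refine ⟨t.sup (·.1), ⋂ n ∈ t, T^[n.1] ⁻¹' U,
    isOpen_biInter_finset fun n _ => hU.preimage (hT.iterate _), ⟨e₀, ?_⟩, fun e he y => ?_⟩
  · exact mem_iInter₂.2 fun n _ => n.2
  · obtain ⟨n, hn, hy⟩ := mem_iUnion₂.1 (ht (mem_univ y))
    exact ⟨n.1, Finset.le_sup (f := fun n : {n // T^[n] e₀ ∈ U} => n.1) hn, mem_iInter₂.1 he n hn,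
      hy⟩

/-- The orbit of `g` stays outside `W` at all positions where the word `u` is `true`. -/
def Avoids {G : Type*} (R : G → G) (W : Set G) (u : List Bool) (g : G) : Prop :=
  ∀ i, u[i]? = some true → R^[i] g ∉ W

theorem Avoids.append {G : Type*} {R : G → G} {W : Set G} {u v : List Bool} {g : G}
    (hu : Avoids R W u g) (hv : Avoids R W v (R^[u.length] g)) : Avoids R W (u ++ v) g := by
  intro i hi
  rw [List.getElem?_append] at hi
  split_ifs at hi with h
  · exact hu i hi
  · have := hv _ hi
    rwa [← iterate_add_apply, Nat.sub_add_cancel (not_lt.1 h)] at this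

/-- Every orbit avoids `W` along arbitrarily long windows appearing within bounded time. -/
def HasUniformGaps {G : Type*} (R : G → G) (W : Set G) : Prop :=
  ∀ L : ℕ, ∃ K : ℕ, ∀ g, ∃ k ≤ K, ∀ i < L, R^[k + i] g ∉ W

/-- The set of concatenations of words of `C`. -/
def Concat (C : Set (List Bool)) : Set (List Bool) :=
  {u | ∃ l : List (List Bool), (∀ c ∈ l, c ∈ C) ∧ u = l.flatten}

/-- The set of infixes of concatenations of words of `C`. -/
def Lang (C : Set (List Bool)) : Set (List Bool) :=
  {u | ∃ v ∈ Concat C, u <:+: v}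

/-- A set of words of bounded length, each using the letter `true`, from which concatenations
avoiding any given orbit can be built. -/
structure IsAvoidingCode {G : Type*} (R : G → G) (W : Set G) (C : Set (List Bool)) : Prop where
  bdd : ∃ m, ∀ c ∈ C, c.length ≤ m
  true_mem : ∀ c ∈ C, true ∈ c
  avoids : ∀ g, ∃ c ∈ C, Avoids R W c g

theorem append_mem_concat {C : Set (List Bool)} {u v : List Bool} (hu : u ∈ Concat C)
    (hv : v ∈ Concat C) : u ++ v ∈ Concat C := by
  obtain ⟨l, hl, rfl⟩ := hu
  obtain ⟨l', hl', rfl⟩ := hv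
  refine ⟨l ++ l', fun c hc => ?_, by simp⟩
  rcases List.mem_append.1 hc with h | h
  exacts [hl c h, hl' c h]

theorem mem_concat_of_mem {C : Set (List Bool)} {u : List Bool} (hu : u ∈ C) : u ∈ Concat C :=
  ⟨[u], by simpa using hu, by simp⟩

theorem nil_mem_concat (C : Set (List Bool)) : [] ∈ Concat C := ⟨[], by simp, by simp⟩

theorem concat_subset_concat {C C' : Set (List Bool)} (h : C' ⊆ Concat C) :
    Concat C' ⊆ Concat C := by
  rintro _ ⟨l, hl, rfl⟩
  induction l with
  | nil => exact nil_mem_concat C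
  | cons c l ih =>
    rw [List.flatten_cons]
    exact append_mem_concat (h (hl c (by simp))) (ih fun d hd => hl d (by simp [hd]))

theorem lang_mono {C C' : Set (List Bool)} (h : C' ⊆ Concat C) : Lang C' ⊆ Lang C :=
  fun _ ⟨v, hv, huv⟩ => ⟨v, concat_subset_concat h hv, huv⟩

theorem mem_lang_of_isInfix {C : Set (List Bool)} {u v : List Bool} (hv : v ∈ Lang C)
    (h : u <:+: v) : u ∈ Lang C :=
  let ⟨w, hw, hvw⟩ := hv
  ⟨w, hw, h.trans hvw⟩

theorem exists_isInfix_append_of_mem_lang {C : Set (List Bool)} {v : List Bool}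
    (hne : C.Nonempty) (hlen : ∀ c ∈ C, v.length ≤ c.length) (hv : v ∈ Lang C) :
    ∃ c₁ ∈ C, ∃ c₂ ∈ C, v <:+: c₁ ++ c₂ := by
  obtain ⟨_, ⟨l, hl, rfl⟩, hv⟩ := hv
  induction l with
  | nil =>
    obtain ⟨c, hc⟩ := hne
    exact ⟨c, hc, c, hc, hv.trans (by simp)⟩
  | cons c l ih =>
    obtain ⟨s, t, hst⟩ := hv
    rw [List.flatten_cons, List.append_assoc, List.append_eq_append_iff] at hst
    rcases hst with ⟨a, hca, ha⟩ | ⟨a, hsa, ha⟩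
    · have hc := hl c (by simp)
      have hpre : v <+: a ++ l.flatten := ⟨t, ha⟩
      cases l with
      | nil =>
        refine ⟨c, hc, c, hc, ?_⟩
        simp only [List.flatten_nil, List.append_nil] at hpre
        exact hpre.isInfix.trans (hca ▸ ⟨s, c, by simp [hca]⟩)
      | cons d l =>
        have hd := hl d (by simp)
        refine ⟨c, hc, d, hd, ?_⟩
        rw [List.flatten_cons, ← List.append_assoc] at hpre
        have : v <+: a ++ d := by
          refine List.prefix_of_prefix_length_le hpre (List.prefix_append _ _) ?_
          have := hlen d hd
          simp
          omega
        exact this.isInfix.trans ⟨s, [], by simp [hca]⟩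
    · exact ih (fun d hd => hl d (by simp [hd])) ⟨a, t, by rw [ha, List.append_assoc]⟩

theorem exists_mem_isInfix_of_mem_lang {C : Set (List Bool)} {u : List Bool} {m : ℕ}
    (hlen : ∀ c ∈ C, c.length ≤ m) (hm : 2 * m < u.length) (hu : u ∈ Lang C) :
    ∃ c ∈ C, c <:+: u := by
  obtain ⟨_, ⟨l, hl, rfl⟩, hu⟩ := hu
  induction l with
  | nil =>
    have := hu.length_le
    simp at this
    simp [this] at hm
  | cons c l ih =>
    obtain ⟨s, t, hst⟩ := hu
    rw [List.flatten_cons, List.append_assoc, List.append_eq_append_iff] at hst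
    rcases hst with ⟨a, hca, ha⟩ | ⟨a, hsa, ha⟩
    · have hc := hlen c (hl c (by simp))
      have hal : a.length ≤ m := by
        rw [hca, List.length_append] at hc
        omega
      cases l with
      | nil =>
        have := congrArg List.length ha
        simp at this
        omega
      | cons d l =>
        have hd := hl d (by simp)
        refine ⟨d, hd, ?_⟩
        have hdl := hlen d hd
        have hpre : a ++ d <+: u ++ t := by
          rw [ha, List.flatten_cons, ← List.append_assoc]
          exact List.prefix_append _ _
        have : a ++ d <+: u := by
          refine List.prefix_of_prefix_length_le hpre (List.prefix_append _ _) ?_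
          simp
          omega
        exact (List.suffix_append a d).isInfix.trans this.isInfix
    · exact ih (fun d hd => hl d (by simp [hd])) ⟨a, t, by rw [ha, List.append_assoc]⟩

namespace IsAvoidingCode

variable {G : Type*} {R : G → G} {W : Set G} {C : Set (List Bool)}

theorem nonempty [Nonempty G] (hC : IsAvoidingCode R W C) : C.Nonempty :=
  let ⟨c, hc, _⟩ := hC.avoids (Classical.arbitrary G)
  ⟨c, hc⟩

theorem exists_concat (hC : IsAvoidingCode R W C) {m : ℕ} (hm : ∀ c ∈ C, c.length ≤ m) (g : G)
    (k : ℕ) : ∃ u ∈ Concat C, k ≤ u.length ∧ u.length ≤ k + m ∧ Avoids R W u g := by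
  induction k with
  | zero => exact ⟨[], nil_mem_concat C, by simp, by simp, by simp [Avoids]⟩
  | succ k ih =>
    obtain ⟨u, hu, h1, h2, h3⟩ := ih
    rcases h1.lt_or_eq with h | h
    · exact ⟨u, hu, h, by omega, h3⟩
    · obtain ⟨c, hc, hcg⟩ := hC.avoids (R^[u.length] g)
      have hpos := List.length_pos_of_mem (hC.true_mem c hc)
      have hle := hm c hc
      refine ⟨u ++ c, append_mem_concat hu (mem_concat_of_mem hc), ?_, ?_, h3.append hcg⟩ <;>
      · rw [List.length_append]
        omega

theorem exists_concat_all_pairs (hC : IsAvoidingCode R W C) :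
    ∃ w ∈ Concat C, ∀ c₁ ∈ C, ∀ c₂ ∈ C, c₁ ++ c₂ <:+: w := by
  obtain ⟨m, hm⟩ := hC.bdd
  have hfin : C.Finite := (List.finite_length_le Bool m).subset hm
  have hfin2 := hfin.prod hfin
  have key : ∀ s : Finset (List Bool × List Bool), (∀ p ∈ s, p.1 ∈ C ∧ p.2 ∈ C) →
      ∃ w ∈ Concat C, ∀ p ∈ s, p.1 ++ p.2 <:+: w := by
    intro s
    induction s using Finset.induction_on with
    | empty => exact fun _ => ⟨[], nil_mem_concat C, by simp⟩
    | insert p s _ ih =>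
      intro hs
      obtain ⟨w, hw, h⟩ := ih fun q hq => hs q (by simp [hq])
      have hp := hs p (by simp)
      refine ⟨(p.1 ++ p.2) ++ w, append_mem_concat (append_mem_concat
        (mem_concat_of_mem hp.1) (mem_concat_of_mem hp.2)) hw, fun q hq => ?_⟩
      rcases Finset.mem_insert.1 hq with rfl | hq
      · exact (List.prefix_append _ _).isInfix
      · exact (h q hq).trans (List.suffix_append _ _).isInfix
  obtain ⟨w, hw, h⟩ := key hfin2.toFinset (by simp)
  exact ⟨w, hw, fun c₁ h₁ c₂ h₂ => h (c₁, c₂) (by simp [h₁, h₂])⟩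

theorem exists_next [Nonempty G] (hC : IsAvoidingCode R W C) (hW : HasUniformGaps R W) :
    ∃ C', IsAvoidingCode R W C' ∧ C' ⊆ Concat C ∧
      ∀ c' ∈ C', ∀ c₁ ∈ C, ∀ c₂ ∈ C, c₁ ++ c₂ <:+: c' := by
  obtain ⟨m, hm⟩ := hC.bdd
  obtain ⟨w, hw, hpairs⟩ := hC.exists_concat_all_pairs
  obtain ⟨K, hK⟩ := hW (w.length + m)
  refine ⟨{c | ∃ u ∈ Concat C, u.length ≤ K + m ∧ c = u ++ w}, ⟨⟨K + m + w.length, ?_⟩, ?_, ?_⟩,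
    ?_, ?_⟩
  · rintro _ ⟨u, -, hu, rfl⟩
    rw [List.length_append]
    omega
  · rintro _ ⟨u, -, -, rfl⟩
    obtain ⟨c, hc⟩ := hC.nonempty
    have h1 := (hpairs c hc c hc).subset (List.mem_append_left c (hC.true_mem c hc))
    exact List.mem_append_right _ h1
  · intro g
    obtain ⟨k, hkK, hk⟩ := hK g
    obtain ⟨u, hu, h1, h2, h3⟩ := hC.exists_concat hm g k
    refine ⟨u ++ w, ⟨u, hu, by omega, rfl⟩, h3.append fun i hi => ?_⟩
    have hiw : i < w.length := (List.getElem?_eq_some_iff.1 hi).1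
    have := hk (u.length - k + i) (by omega)
    rwa [← iterate_add_apply, show i + u.length = k + (u.length - k + i) by omega]
  · rintro _ ⟨u, hu, -, rfl⟩
    exact append_mem_concat hu hw
  · rintro _ ⟨u, -, -, rfl⟩ c₁ h₁ c₂ h₂
    exact (hpairs c₁ h₁ c₂ h₂).trans (List.suffix_append _ _).isInfix

end IsAvoidingCode

theorem HasUniformGaps.exists_isAvoidingCode {G : Type*} {R : G → G} {W : Set G}
    (hW : HasUniformGaps R W) : ∃ C, IsAvoidingCode R W C := by
  obtain ⟨K, hK⟩ := hW 1
  refine ⟨{c | ∃ k ≤ K, c = List.replicate k false ++ [true]}, ⟨K + 1, ?_⟩, ?_, fun g => ?_⟩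
  · rintro _ ⟨k, hk, rfl⟩
    simpa using hk
  · rintro _ ⟨k, -, rfl⟩
    simp
  · obtain ⟨k, hk, h⟩ := hK g
    refine ⟨_, ⟨k, hk, rfl⟩, Avoids.append (fun i hi => ?_) fun i hi => ?_⟩
    · simp [List.getElem?_replicate] at hi
    · rw [List.getElem?_singleton] at hi
      split_ifs at hi with h0
      subst h0
      simpa using h 0 one_pos

/-- A sequence of avoiding codes, each refining the previous one. -/
theorem HasUniformGaps.exists_seq {G : Type*} [Nonempty G] {R : G → G} {W : Set G}
    (hW : HasUniformGaps R W) :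
    ∃ C : ℕ → Set (List Bool), (∀ n, IsAvoidingCode R W (C n)) ∧
      (∀ n, C (n + 1) ⊆ Concat (C n)) ∧
      ∀ n, ∀ c' ∈ C (n + 1), ∀ c₁ ∈ C n, ∀ c₂ ∈ C n, c₁ ++ c₂ <:+: c' := by
  obtain ⟨C₀, hC₀⟩ := hW.exists_isAvoidingCode
  choose! f hf using fun C (hC : IsAvoidingCode R W C) => hC.exists_next hW
  have hgood : ∀ n, IsAvoidingCode R W (f^[n] C₀) := by
    intro n
    induction n with
    | zero => exact hC₀
    | succ n ih =>
      rw [iterate_succ_apply']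
      exact (hf _ ih).1
  refine ⟨fun n => f^[n] C₀, hgood, fun n => ?_, fun n => ?_⟩ <;> simp only [iterate_succ_apply']
  · exact (hf _ (hgood n)).2.1
  · exact (hf _ (hgood n)).2.2

/-- The initial word of length `N` of a sequence. -/
def initialWord (N : ℕ) (z : ℕ → Bool) : List Bool :=
  List.ofFn fun i : Fin N => z i

theorem initialWord_getElem? (N : ℕ) (z : ℕ → Bool) (i : ℕ) :
    (initialWord N z)[i]? = if i < N then some (z i) else none := by
  simp [initialWord, List.getElem?_ofFn]

theorem initialWord_isPrefix_of_le {M N : ℕ} (h : M ≤ N) (z : ℕ → Bool) :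
    initialWord M z <+: initialWord N z := by
  rw [List.prefix_iff_getElem?]
  intro i hi
  have hi' : i < M := by simpa [initialWord] using hi
  rw [initialWord_getElem?, if_pos (hi'.trans_le h)]
  simp [initialWord]

theorem initialWord_shift_isInfix (N : ℕ) (z : ℕ → Bool) :
    initialWord N (fun i => z (i + 1)) <:+: initialWord (N + 1) z := by
  refine List.IsSuffix.isInfix ⟨[z 0], ?_⟩
  simp [initialWord, List.ofFn_succ]

theorem isClosed_setOf_initialWord_mem (N : ℕ) (A : Set (List Bool)) :
    IsClosed {z : ℕ → Bool | initialWord N z ∈ A} := by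
  have hc : Continuous fun (z : ℕ → Bool) (i : Fin N) => z i := by fun_prop
  exact (isClosed_discrete {f : Fin N → Bool | List.ofFn f ∈ A}).preimage hc

theorem exists_shift_of_isInfix {M N : ℕ} {z z' : ℕ → Bool}
    (h : initialWord N z' <:+: initialWord M z) : ∃ k, ∀ i < N, z (i + k) = z' i := by
  obtain ⟨s, t, hst⟩ := h
  refine ⟨s.length, fun i hi => ?_⟩
  have h1 := congrArg (fun l : List Bool => l[i + s.length]?) hst
  have h2 : (initialWord N z').length = N := by simp [initialWord]
  simp only [initialWord_getElem?] at h1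
  rw [List.append_assoc, List.getElem?_append_right (by omega), Nat.add_sub_cancel,
    List.getElem?_append_left (by omega), initialWord_getElem?, if_pos hi] at h1
  split_ifs at h1
  simpa using h1.symm

/-- The shift on binary sequences. -/
def shift (z : ℕ → Bool) : ℕ → Bool := fun i => z (i + 1)

theorem shift_iterate (k : ℕ) (z : ℕ → Bool) (i : ℕ) : shift^[k] z i = z (i + k) := by
  induction k generalizing z with
  | zero => rfl
  | succ k ih =>
    rw [iterate_succ_apply, ih]
    exact congrArg z (by omega)

/-- If every orbit has long gaps in `W`, there is a minimal subshift, all of whose points use the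
letter `true`, such that every orbit avoids `W` along some point of the subshift. -/
theorem HasUniformGaps.exists_minimal_subshift {G : Type*} [Nonempty G]
    {R : G → G} {W : Set G} (hW : HasUniformGaps R W) :
    ∃ (Z : Set (ℕ → Bool)) (hZ : MapsTo shift Z Z), IsClosed Z ∧
      IsMinimalSys (hZ.restrict shift Z Z) ∧ (∀ z ∈ Z, ∃ i, z i = true) ∧
      ∀ g, ∃ z ∈ Z, ∀ i, z i = true → R^[i] g ∉ W := by
  obtain ⟨C, hC, hsub, hpairs⟩ := hW.exists_seq
  have hlen : ∀ n, ∀ c ∈ C n, n + 1 ≤ c.length := by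
    intro n
    induction n with
    | zero => exact fun c hc => List.length_pos_of_mem ((hC 0).true_mem c hc)
    | succ n ih =>
      intro c hc
      obtain ⟨d, hd⟩ := (hC n).nonempty
      have h1 := (hpairs n c hc d hd d hd).length_le
      rw [List.length_append] at h1
      have := ih d hd
      omega
  have hanti : Antitone fun n => Lang (C n) := antitone_nat_of_succ_le fun n => lang_mono (hsub n)
  let Z : Set (ℕ → Bool) := {z | ∀ n N, initialWord N z ∈ Lang (C n)}
  have hZ : MapsTo shift Z Z := fun z hz n N =>
    mem_lang_of_isInfix (hz n (N + 1)) (initialWord_shift_isInfix N z)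
  refine ⟨Z, hZ, ?_, ?_, ?_, ?_⟩
  · simp only [Z, ofPred_forall]
    exact isClosed_iInter fun n => isClosed_iInter fun N => isClosed_setOf_initialWord_mem N _
  · rintro ⟨z, hz⟩
    rw [dense_iff_inter_open]
    rintro _ ⟨U, hU, rfl⟩ ⟨⟨z', hz'⟩, hz'U⟩
    obtain ⟨I, u, hu, hIU⟩ := isOpen_pi_iff.1 hU z' hz'U
    obtain ⟨N, hN⟩ := I.exists_nat_subset_range
    obtain ⟨c₁, h₁, c₂, h₂, hv⟩ := exists_isInfix_append_of_mem_lang (hC N).nonempty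
      (v := initialWord N z')
      (fun c hc => by simpa [initialWord] using (Nat.le_succ N).trans (hlen N c hc)) (hz' N N)
    obtain ⟨m, hm⟩ := (hC (N + 1)).bdd
    obtain ⟨c, hc, hcz⟩ := exists_mem_isInfix_of_mem_lang hm
      (u := initialWord (2 * m + 1) z) (by simp [initialWord]) (hz _ _)
    obtain ⟨k, hk⟩ := exists_shift_of_isInfix ((hv.trans (hpairs N c hc c₁ h₁ c₂ h₂)).trans hcz)
    refine ⟨_, ?_, k, rfl⟩
    rw [mem_preimage, hZ.coe_iterate_restrict]
    refine hIU fun i hi => ?_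
    simp only [shift_iterate]
    rw [hk i (Finset.mem_range.1 (hN hi))]
    exact (hu i hi).2
  · intro z hz
    obtain ⟨m, hm⟩ := (hC 0).bdd
    obtain ⟨c, hc, hcz⟩ := exists_mem_isInfix_of_mem_lang hm
      (u := initialWord (2 * m + 1) z) (by simp [initialWord]) (hz _ _)
    have := hcz.subset ((hC 0).true_mem c hc)
    rw [initialWord, List.mem_ofFn] at this
    obtain ⟨i, hi⟩ := this
    exact ⟨i, hi⟩
  · intro g
    let Q : ℕ → Set (ℕ → Bool) := fun N =>
      {z | initialWord N z ∈ Lang (C N)} ∩ {z | ∀ i < N, z i = true → R^[i] g ∉ W}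
    have hQcl : ∀ N, IsClosed (Q N) := by
      refine fun N => (isClosed_setOf_initialWord_mem N _).inter ?_
      simp only [ofPred_forall]
      refine isClosed_iInter fun i => isClosed_iInter fun _ => ?_
      exact (isClosed_discrete {b : Bool | b = true → R^[i] g ∉ W}).preimage
        (continuous_apply (A := fun _ => Bool) i)
    obtain ⟨z, hz⟩ := IsCompact.nonempty_iInter_of_sequence_nonempty_isCompact_isClosed Q
      (fun N z hz => ⟨hanti N.le_succ (mem_lang_of_isInfix hz.1
        (initialWord_isPrefix_of_le N.le_succ z).isInfix),
        fun i hi => hz.2 i (hi.trans N.lt_succ_self)⟩)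
      (fun N => by
        obtain ⟨m, hm⟩ := (hC N).bdd
        obtain ⟨u, hu, hNu, -, hav⟩ := (hC N).exists_concat hm g N
        refine ⟨fun i => u.getD i false, ⟨u, hu, List.IsPrefix.isInfix ?_⟩, fun i hi h => ?_⟩
        · rw [List.prefix_iff_getElem?]
          intro i hi
          have hi' : i < N := by simpa [initialWord] using hi
          simp [initialWord, hi'.trans_le hNu]
        · refine hav i ?_
          rw [List.getElem?_eq_getElem (hi.trans_le hNu)]
          simpa [hi.trans_le hNu] using h)
      (hQcl 0).isCompact hQcl
    rw [mem_iInter] at hz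
    refine ⟨z, fun n N => ?_, fun i => (hz (i + 1)).2 i i.lt_succ_self⟩
    exact hanti (le_max_left n N) (mem_lang_of_isInfix (hz (max n N)).1
      (initialWord_isPrefix_of_le (le_max_right n N) z).isInfix)

theorem IsOpen.exists_isOpen_isClosed_subset {X : Type*} [TopologicalSpace X] [RegularSpace X]
    {U : Set X} (hU : IsOpen U) (hne : U.Nonempty) :
    ∃ V F : Set X, IsOpen V ∧ V.Nonempty ∧ IsClosed F ∧ V ⊆ F ∧ F ⊆ U := by
  obtain ⟨x, hx⟩ := hne
  obtain ⟨F, hF, hFc, hFU⟩ := exists_mem_nhds_isClosed_subset (hU.mem_nhds hx)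
  exact ⟨interior F, F, isOpen_interior, ⟨x, mem_interior_iff_mem_nhds.2 hF⟩, hFc,
    interior_subset, hFU⟩

/-- A system disjoint from all minimal systems has points with syndetic return times to any given
nonempty open set. -/
theorem DisjointFromMinimal.exists_syndetic {G : Type} [TopologicalSpace G] [CompactSpace G]
    [RegularSpace G] {R : G → G} (h : DisjointFromMinimal R) (hR : Continuous R) {O : Set G}
    (hO : IsOpen O) (hne : O.Nonempty) : ∃ g, Syndetic {n | R^[n] g ∈ O} := by
  by_contra! hcon
  obtain ⟨W₀, W, hW₀, hW₀ne, hW, hW₀W, hWO⟩ := hO.exists_isOpen_isClosed_subset hne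
  have hgap : HasUniformGaps R W := by
    intro L
    obtain ⟨t, ht⟩ := (isCompact_univ (X := G)).elim_finite_subcover
      (fun k : ℕ => ⋂ i ∈ Finset.range L, R^[k + i] ⁻¹' Wᶜ)
      (fun k => isOpen_biInter_finset fun i _ => hW.isOpen_compl.preimage (hR.iterate _))
      (fun g _ => by
        have := hcon g
        simp only [Syndetic, not_exists, not_forall, not_and] at this
        obtain ⟨k, hk⟩ := this L
        refine mem_iUnion.2 ⟨k, mem_iInter₂.2 fun i hi hmem => ?_⟩
        exact hk i (Finset.mem_range.1 hi).le (hWO hmem))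
    refine ⟨t.sup id, fun g => ?_⟩
    obtain ⟨k, hk, hg⟩ := mem_iUnion₂.1 (ht (mem_univ g))
    exact ⟨k, Finset.le_sup (f := id) hk,
      fun i hi => mem_iInter₂.1 hg i (Finset.mem_range.2 hi)⟩
  obtain ⟨g₀, hg₀⟩ := hW₀ne
  have : Nonempty G := ⟨g₀⟩
  obtain ⟨Z, hZ, hZc, hZmin, hZtrue, hZav⟩ := hgap.exists_minimal_subshift
  have : CompactSpace Z := isCompact_iff_compactSpace.1 hZc.isCompact
  have hshift : Continuous shift := continuous_pi fun i => continuous_apply (i + 1)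
  have hcont : Continuous (hZ.restrict shift Z Z) := hshift.restrict hZ
  have hJ : {p : G × Z | ∀ i, p.2.1 i = true → R^[i] p.1 ∉ W₀} = univ := by
    refine (h.disjointSys hcont hZmin).eq_univ_of_forall_exists hZmin ?_ (fun p hp i hi => ?_)
      fun g => ?_
    · simp only [ofPred_forall]
      refine isClosed_iInter fun i => isClosed_imp ?_ ?_
      · have hc : Continuous fun p : G × Z => p.2.1 i :=
          (continuous_apply i).comp (continuous_subtype_val.comp continuous_snd)
        exact (isOpen_discrete {true}).preimage hc
      · exact (hW₀.preimage ((hR.iterate i).comp continuous_fst)).isClosed_compl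
    · simpa only [← iterate_succ_apply] using hp (i + 1) hi
    · obtain ⟨z, hz, hzg⟩ := hZav g
      exact ⟨⟨z, hz⟩, fun i hi hmem => hzg i hi (hW₀W hmem)⟩
  obtain ⟨z, hz, -⟩ := hZav g₀
  obtain ⟨i, hi⟩ := hZtrue z hz
  have hzi : shift^[i] z ∈ Z := hZ.iterate i hz
  have : (g₀, (⟨_, hzi⟩ : Z)) ∈ {p : G × Z | ∀ i, p.2.1 i = true → R^[i] p.1 ∉ W₀} :=
    hJ ▸ mem_univ _
  exact this 0 (by simpa [shift_iterate] using hi) hg₀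

theorem exists_minimal_subsystem {X : Type*} [TopologicalSpace X] [CompactSpace X] {F : X → X}
    (hF : Continuous F) {D : Set X} (hD : IsClosed D) (hne : D.Nonempty) (hFD : MapsTo F D D) :
    ∃ (Ω : Set X) (hΩ : MapsTo F Ω Ω), Ω ⊆ D ∧ IsClosed Ω ∧ Ω.Nonempty ∧
      IsMinimalSys (hΩ.restrict F Ω Ω) := by
  let 𝒮 : Set (Set X) := {A | IsClosed A ∧ A.Nonempty ∧ MapsTo F A A}
  obtain ⟨Ω, hΩD, ⟨⟨hΩc, hΩne, hΩ⟩, hmin⟩⟩ := zorn_superset_nonempty 𝒮 (by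
    intro c hc hchain hcne
    refine ⟨⋂₀ c, ⟨isClosed_sInter fun A hA => (hc hA).1, ?_, ?_⟩,
      fun s hs => sInter_subset_of_mem hs⟩
    · have : Nonempty c := hcne.to_subtype
      exact IsCompact.nonempty_sInter_of_directed_nonempty_isCompact_isClosed
        (fun A hA B hB => (hchain.total hA hB).elim
          (fun h => ⟨A, hA, subset_rfl, h⟩) fun h => ⟨B, hB, h, subset_rfl⟩)
        (fun A hA => (hc hA).2.1)
        (fun A hA => (hc hA).1.isCompact) (fun A hA => (hc hA).1)
    · exact fun x hx A hA => (hc hA).2.2 (hx A hA)) D ⟨hD, hne, hFD⟩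
  refine ⟨Ω, hΩ, hΩD, hΩc, hΩne, fun y => ?_⟩
  have horb : orbit F y.1 ⊆ Ω := by
    rintro _ ⟨n, rfl⟩
    exact hΩ.iterate n y.2
  have hmaps : MapsTo F (orbit F y.1) (orbit F y.1) := by
    rintro _ ⟨n, rfl⟩
    exact ⟨n + 1, iterate_succ_apply' F n y.1⟩
  have hsub : Ω ⊆ closure (orbit F y.1) := hmin ⟨isClosed_closure,
    ⟨y.1, subset_closure ⟨0, rfl⟩⟩, hmaps.closure hF⟩
    (closure_minimal horb hΩc)
  rw [Subtype.dense_iff]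
  convert hsub using 2
  simp only [orbit, ← range_comp]
  exact congrArg range (funext fun n => hΩ.coe_iterate_restrict y n)

/-- The product of a system disjoint from all minimal systems with a minimal system has minimal
subsystems meeting any given open box. -/
theorem DisjointFromMinimal.exists_minimal_inter_prod {E : Type} [TopologicalSpace E]
    [CompactSpace E] [RegularSpace E] {T : E → E} (h : DisjointFromMinimal T) (hT : Continuous T)
    {Y : Type} [TopologicalSpace Y] [CompactSpace Y] [TopologicalSpace.MetrizableSpace Y]
    {S : Y → Y} (hSc : Continuous S) (hS : IsMinimalSys S) {U : Set E} {V : Set Y}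
    (hU : IsOpen U) (hV : IsOpen V) (hUne : U.Nonempty) (hVne : V.Nonempty) :
    ∃ (Ω : Set (E × Y)) (hΩ : MapsTo (Prod.map T S) Ω Ω), IsClosed Ω ∧
      IsMinimalSys (hΩ.restrict (Prod.map T S) Ω Ω) ∧ (Ω ∩ U ×ˢ V).Nonempty := by
  obtain ⟨U', A, hU', hU'ne, hA, hU'A, hAU⟩ := hU.exists_isOpen_isClosed_subset hUne
  obtain ⟨V', B, hV', hV'ne, hB, hV'B, hBV⟩ := hV.exists_isOpen_isClosed_subset hVne
  obtain ⟨N, O, hO, hOne, hON⟩ :=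
    (h.disjointSys hSc hS).exists_simultaneous hT hSc hS hU' hV' hU'ne hV'ne
  obtain ⟨e, L, heL⟩ := h.exists_syndetic hT hO hOne
  obtain ⟨y, -⟩ := hVne
  let F : E × Y → E × Y := Prod.map T S
  have hF : Continuous F := hT.prodMap hSc
  let D : Set (E × Y) := {p | ∀ i, ∃ n ∈ Finset.range (N + L + 1), F^[i + n] p ∈ A ×ˢ B}
  have hD : IsClosed D := by
    have : D = ⋂ i, ⋃ n ∈ Finset.range (N + L + 1), F^[i + n] ⁻¹' (A ×ˢ B) := by
      ext p
      simp only [D, mem_ofPred_eq, mem_iInter, mem_iUnion, mem_preimage, exists_prop]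
    rw [this]
    exact isClosed_iInter fun i => isClosed_biUnion_finset fun n _ =>
      (hA.prod hB).preimage (hF.iterate _)
  have hDne : (e, y) ∈ D := by
    intro i
    obtain ⟨j, hj, hij⟩ := heL i
    obtain ⟨n, hn, h1, h2⟩ := hON _ hij (S^[i + j] y)
    refine ⟨j + n, Finset.mem_range.2 (by omega), ?_⟩
    rw [← iterate_add_apply, show n + (i + j) = i + (j + n) by omega] at h1 h2
    simp only [F, Prod.map_iterate]
    exact ⟨hU'A h1, hV'B h2⟩
  have hFD : MapsTo F D D := fun p hp i => by
    obtain ⟨n, hn, hp⟩ := hp (i + 1)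
    refine ⟨n, hn, ?_⟩
    rwa [← iterate_succ_apply, show (i + n).succ = i + 1 + n by omega]
  obtain ⟨Ω, hΩ, hΩD, hΩc, ⟨w, hw⟩, hΩmin⟩ := exists_minimal_subsystem hF hD ⟨_, hDne⟩ hFD
  obtain ⟨n, -, hn⟩ := hΩD hw 0
  exact ⟨Ω, hΩ, hΩc, hΩmin, _, hΩ.iterate _ hw, hAU hn.1, hBV hn.2⟩

/-- Disjointness from all minimal systems is preserved by products. -/
theorem DisjointFromMinimal.prod {E G : Type} [MetricSpace E] [CompactSpace E] [MetricSpace G]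
    [CompactSpace G] {T : E → E} {R : G → G} (hE : DisjointFromMinimal T)
    (hG : DisjointFromMinimal R) (hT : Continuous T) (hR : Continuous R) :
    DisjointFromMinimal (Prod.map T R) := by
  intro 𝒴 hS J hJ
  obtain ⟨-, hJc, hJinv, hJfst, -⟩ := hJ
  set S := 𝒴.map
  have hSc : Continuous S := 𝒴.cont
  by_contra hne
  obtain ⟨⟨⟨e₀, g₀⟩, y₀⟩, hp⟩ := (ne_univ_iff_exists_notMem J).1 hne
  obtain ⟨U₁₂, V, hU₁₂, hV, hp₁₂, hy₀, hsub⟩ := isOpen_prod_iff.1 hJc.isOpen_compl _ _ hp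
  obtain ⟨U₁, U₂, hU₁, hU₂, he₀, hg₀, hsub'⟩ := isOpen_prod_iff.1 hU₁₂ _ _ hp₁₂
  obtain ⟨Ω, hΩ, hΩc, hΩmin, w, hwΩ, hwUV⟩ :=
    hE.exists_minimal_inter_prod hT hSc hS hU₁ hV ⟨_, he₀⟩ ⟨_, hy₀⟩
  let F : E × 𝒴.carrier → E × 𝒴.carrier := Prod.map T S
  have hF : Continuous F := hT.prodMap hSc
  have : CompactSpace Ω := isCompact_iff_compactSpace.1 hΩc.isCompact
  have hFΩ : Continuous (hΩ.restrict F Ω Ω) := hF.restrict hΩ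
  obtain ⟨N, O, hO, hOne, hON⟩ := (hG.disjointSys hFΩ hΩmin).exists_simultaneous hR hFΩ hΩmin hU₂
    ((hU₁.prod hV).preimage continuous_subtype_val) ⟨_, hg₀⟩ ⟨⟨w, hwΩ⟩, hwUV⟩
  obtain ⟨g, L, hgL⟩ := hG.exists_syndetic hR hO hOne
  classical
  let Q : Set (E × 𝒴.carrier) :=
    ⋂ n ∈ (Finset.range (L + N + 1)).filter (fun n => F^[n] w ∈ U₁ ×ˢ V), F^[n] ⁻¹' (U₁ ×ˢ V)
  have hQ : IsOpen Q :=
    isOpen_biInter_finset fun n _ => (hU₁.prod hV).preimage (hF.iterate n)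
  have hwQ : w ∈ Q := mem_iInter₂.2 fun n hn => (Finset.mem_filter.1 hn).2
  obtain ⟨O₁, V₁, hO₁, hV₁, hw₁, hw₂, hOV⟩ := isOpen_prod_iff.1 hQ w.1 w.2 hwQ
  obtain ⟨_, E', -, ⟨e, he⟩, hE'⟩ := (hE.disjointSys hSc hS).exists_simultaneous hT hSc hS hO₁ hV₁
    ⟨_, hw₁⟩ ⟨_, hw₂⟩
  obtain ⟨⟨_, y⟩, hyJ, hy⟩ : (e, g) ∈ Prod.fst '' J := hJfst ▸ mem_univ _
  simp only at hy
  subst hy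
  obtain ⟨s, -, hs₁, hs₂⟩ := hE' e he y
  obtain ⟨j, hj, hsj⟩ := hgL s
  obtain ⟨n, hn, hn₁, hn₂⟩ := hON _ hsj ⟨F^[j] w, hΩ.iterate j hwΩ⟩
  rw [mem_preimage, hΩ.coe_iterate_restrict, ← iterate_add_apply] at hn₂
  have hQs : (T^[s] e, S^[s] y) ∈ Q := hOV ⟨hs₁, hs₂⟩
  have hbox := mem_iInter₂.1 hQs (n + j)
    (Finset.mem_filter.2 ⟨Finset.mem_range.2 (by omega), hn₂⟩)
  simp only [F, Prod.map_iterate, mem_preimage, Prod.map_apply, ← iterate_add_apply] at hbox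
  have hJn : ∀ n, (((T^[n] e, R^[n] g), S^[n] y) : (E × G) × 𝒴.carrier) ∈ J := by
    intro n
    induction n with
    | zero => exact hyJ
    | succ n ih =>
      simp only [iterate_succ_apply']
      exact hJinv _ ih
  rw [← iterate_add_apply] at hn₁
  have : n + j + s = n + (s + j) := by omega
  rw [this] at hbox
  exact hsub ⟨hsub' ⟨hbox.1, hn₁⟩, hbox.2⟩ (hJn _)

open TopologicalSpace in
/-- Every finite nonempty set lies in the image of a system disjoint from all minimal systems under
an equivariant map to the hyperspace. -/
theorem DisjointFromMinimal.exists_cover {X : Type} [MetricSpace X] [CompactSpace X] {T : X → X}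
    (hT : Continuous T) (h : DisjointFromMinimal T) {A : Set X} (hA : A.Finite)
    (hne : A.Nonempty) :
    ∃ (P : Type) (_ : MetricSpace P) (_ : CompactSpace P) (R : P → P)
      (ρ : P → NonemptyCompacts X), Continuous R ∧ DisjointFromMinimal R ∧ Continuous ρ ∧
        (∀ p, ρ (R p) = hyperMap T hT (ρ p)) ∧ ∃ p, (ρ p : Set X) = A := by
  have key : ∀ x, ({T x} : NonemptyCompacts X) = hyperMap T hT {x} := fun x => by
    ext y
    simp [hyperMap]
  revert hne
  refine hA.induction_on A (by simp) ?_
  intro a A _ _ ih _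
  rcases A.eq_empty_or_nonempty with rfl | hne
  · exact ⟨X, inferInstance, inferInstance, T, fun x => {x}, hT, h,
      NonemptyCompacts.continuous_singleton, key, a, by simp⟩
  · obtain ⟨P, _, _, R, ρ, hR, hRd, hρ, hequiv, p, hp⟩ := ih hne
    refine ⟨X × P, inferInstance, inferInstance, Prod.map T R, fun q => {q.1} ⊔ ρ q.2,
      hT.prodMap hR, h.prod hRd hT hR,
      (NonemptyCompacts.continuous_singleton.comp continuous_fst).sup (hρ.comp continuous_snd),
      fun q => ?_, (a, p), ?_⟩
    · simp only [Prod.map_fst, Prod.map_snd, key, hequiv]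
      ext y
      simp [hyperMap, image_insert_eq]
    · simp [hp]

open TopologicalSpace in
theorem DisjointFromMinimal.hyperspace {X : Type} [MetricSpace X] [CompactSpace X] {T : X → X}
    (hT : Continuous T) (h : DisjointFromMinimal T) : DisjointFromMinimal (hyperMap T hT) := by
  intro 𝒴 hS J hJ
  obtain ⟨-, hJc, hJinv, hJfst, -⟩ := hJ
  have hfin : ∀ A : NonemptyCompacts X, (A : Set X).Finite → ∀ y, (A, y) ∈ J := by
    intro A hA y
    obtain ⟨P, _, _, R, ρ, hR, hRd, hρ, hequiv, p, hp⟩ := h.exists_cover hT hA A.nonempty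
    have huniv : Prod.map ρ id ⁻¹' J = univ := by
      refine (hRd 𝒴 hS).eq_univ_of_forall_exists hS (hJc.preimage (hρ.prodMap continuous_id))
        (fun q hq => ?_) fun q => ?_
      · simpa [hequiv] using hJinv _ hq
      · obtain ⟨⟨_, y⟩, hy, rfl⟩ : ρ q ∈ Prod.fst '' J := hJfst ▸ mem_univ _
        exact ⟨y, hy⟩
    have hpy : (p, y) ∈ Prod.map ρ id ⁻¹' J := huniv ▸ mem_univ _
    rwa [mem_preimage, Prod.map_apply, SetLike.coe_injective hp] at hpy
  refine eq_univ_of_forall fun ⟨A, y⟩ => ?_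
  have hcl : IsClosed {A : NonemptyCompacts X | (A, y) ∈ J} :=
    hJc.preimage (Continuous.prodMk_left y)
  exact closure_minimal (fun (B : NonemptyCompacts X) (hB : (B : Set X).Finite) => hfin B hB y) hcl
    (NonemptyCompacts.dense_setOfPred_finite A)

open TopologicalSpace in
theorem isClosed_setOf_exists_mem_prod {X Y : Type*} [MetricSpace X] [TopologicalSpace Y]
    {J : Set (X × Y)} (hJ : IsClosed J) :
    IsClosed {p : NonemptyCompacts X × Y | ∃ a ∈ p.1, (a, p.2) ∈ J} := by
  rw [← isOpen_compl_iff, isOpen_iff_forall_mem_open]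
  rintro ⟨A, y⟩ hA
  simp only [mem_compl_iff, mem_ofPred_eq, not_exists, not_and] at hA
  obtain ⟨U, V, hU, hV, hAU, hyV, hUV⟩ := generalized_tube_lemma A.isCompact
    (isCompact_singleton (x := y)) hJ.isOpen_compl (by
      rintro ⟨a, b⟩ ⟨ha, rfl⟩
      exact hA a ha)
  refine ⟨{B : NonemptyCompacts X | (B : Set X) ⊆ U} ×ˢ V, ?_,
    (NonemptyCompacts.isOpen_subsets_of_isOpen hU).prod hV, hAU, hyV rfl⟩
  rintro ⟨B, b⟩ ⟨hB, hb⟩ ⟨a, ha, hab⟩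
  exact hUV ⟨hB ha, hb⟩ hab

open TopologicalSpace in
theorem DisjointFromMinimal.of_hyperspace {X : Type} [MetricSpace X] [CompactSpace X] {T : X → X}
    (hT : Continuous T) (h : DisjointFromMinimal (hyperMap T hT)) :
    DisjointFromMinimal T := by
  intro 𝒴 hS J hJ
  obtain ⟨-, hJc, hJinv, hJfst, -⟩ := hJ
  have huniv := (h 𝒴 hS).eq_univ_of_forall_exists hS (isClosed_setOf_exists_mem_prod hJc)
    (fun p ⟨a, ha, haJ⟩ => ⟨T a, mem_image_of_mem T ha, hJinv _ haJ⟩) fun A => by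
      obtain ⟨a, ha⟩ := A.nonempty
      obtain ⟨⟨_, y⟩, hy, rfl⟩ : a ∈ Prod.fst '' J := hJfst ▸ mem_univ _
      exact ⟨y, _, ha, hy⟩
  refine eq_univ_of_forall fun ⟨x, y⟩ => ?_
  obtain ⟨a, ha, haJ⟩ := huniv.symm.subset (mem_univ (({x} : NonemptyCompacts X), y))
  rw [NonemptyCompacts.mem_singleton] at ha
  rwa [← ha]

theorem stmt_16 {X : Type} [MetricSpace X] [CompactSpace X] (T : X → X)
    (hTc : Continuous T) (hTs : Function.Surjective T) (hTtr : IsTransitiveSys T) :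
    (∀ 𝒴 : TDS, IsMinimalSys 𝒴.map → DisjointSys T 𝒴.map) ↔
      (∀ 𝒴 : TDS, IsMinimalSys 𝒴.map → DisjointSys (hyperMap T hTc) 𝒴.map) := by
  exact ⟨fun h => DisjointFromMinimal.hyperspace hTc h,
    fun h => DisjointFromMinimal.of_hyperspace hTc h⟩
end

section
/- Let (X,T) be a transitive topological dynamical system that is disjoint from every minimal topological dynamical system. Then for every n ∈ ℕ the system (X, T^n) is also disjoint from every minimal topological dynamical system. -/
open Set Function Filter Topology

/-- The discrete suspension of height `n` over `S`: climb one level at a time, and apply `S` when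
falling from the top level back to level `0`. -/
def towerMap {Y : Type*} (S : Y → Y) (n : ℕ) (p : Y × Set.Iio n) : Y × Set.Iio n :=
  if h : p.2.1 + 1 < n then (p.1, ⟨p.2.1 + 1, h⟩)
  else (S p.1, ⟨0, lt_of_le_of_lt (Nat.zero_le _) p.2.2⟩)

section Tower

variable {Y : Type*} (S : Y → Y) {n : ℕ}

lemma towerMap_of_lt (y : Y) {i : ℕ} (hi : i < n) (h : i + 1 < n) :
    towerMap S n (y, ⟨i, hi⟩) = (y, ⟨i + 1, h⟩) :=
  dif_pos h

lemma towerMap_of_eq (y : Y) {i : ℕ} (hi : i < n) (h : i + 1 = n) :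
    towerMap S n (y, ⟨i, hi⟩) = (S y, ⟨0, show 0 < n by omega⟩) :=
  dif_neg (by simp [h])

lemma towerMap_iterate_add (y : Y) {i : ℕ} (j : ℕ) (h : i + j < n) :
    (towerMap S n)^[j] (y, ⟨i, show i < n by omega⟩) = (y, ⟨i + j, h⟩) := by
  induction j with
  | zero => rfl
  | succ j ih =>
    rw [iterate_succ_apply', ih (by omega), towerMap_of_lt S y (by omega) (by omega)]
    rfl

lemma towerMap_iterate_sub (y : Y) {i : ℕ} (hi : i < n) :
    (towerMap S n)^[n - i] (y, ⟨i, hi⟩) = (S y, ⟨0, show 0 < n by omega⟩) := by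
  obtain ⟨j, hj⟩ : ∃ j, n - i = j + 1 := ⟨n - i - 1, by omega⟩
  rw [hj, iterate_succ_apply', towerMap_iterate_add S y j (by omega),
    towerMap_of_eq S y (by omega) (by omega)]

lemma towerMap_iterate_mul (hn : 0 < n) (y : Y) (m : ℕ) :
    (towerMap S n)^[n * m] (y, ⟨0, hn⟩) = (S^[m] y, ⟨0, hn⟩) := by
  induction m with
  | zero => rfl
  | succ m ih =>
    rw [Nat.mul_succ, add_comm, iterate_add_apply, ih, iterate_succ_apply']
    exact towerMap_iterate_sub S _ hn

variable {S}

lemma surjective_towerMap (hS : Surjective S) : Surjective (towerMap S n) := by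
  rintro ⟨y, i, hi⟩
  have hi' : i < n := hi
  cases i with
  | zero =>
    obtain ⟨z, rfl⟩ := hS y
    exact ⟨(z, ⟨n - 1, show n - 1 < n by omega⟩), towerMap_of_eq S z _ (by omega)⟩
  | succ i => exact ⟨(y, ⟨i, show i < n by omega⟩), towerMap_of_lt S y _ hi'⟩

variable [TopologicalSpace Y]

lemma continuous_towerMap (hS : Continuous S) : Continuous (towerMap S n) := by
  refine continuous_prod_of_discrete_right.2 fun b => ?_
  by_cases h : b.1 + 1 < n
  · simp only [towerMap, h, dite_true]
    fun_prop
  · simp only [towerMap, h, dite_false]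
    fun_prop

lemma isMinimalSys_towerMap (hS : IsMinimalSys S) : IsMinimalSys (towerMap S n) := by
  rintro ⟨y, i, hi⟩
  rw [dense_iff_inter_open]
  rintro U hU ⟨⟨z, j, hj⟩, hz⟩
  have hi' : i < n := hi
  have hj' : j < n := hj
  obtain ⟨_, hw, m, rfl⟩ := (hS (S y)).inter_open_nonempty
    ((fun w => (w, (⟨j, hj⟩ : Set.Iio n))) ⁻¹' U) (hU.preimage (by fun_prop)) ⟨z, hz⟩
  refine ⟨_, hw, j + (n * m + (n - i)), ?_⟩
  simp only [iterate_add_apply]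
  rw [towerMap_iterate_sub S y hi', towerMap_iterate_mul S (by omega),
    towerMap_iterate_add S _ j (by omega)]
  simp

/-- A joining of `T^[n]` with `S` spreads out to a joining of `T` with the suspension of `S`. -/
lemma IsJoining.tower {X : Type*} [TopologicalSpace X] [CompactSpace X] [T2Space X]
    [CompactSpace Y] [T2Space Y] {T : X → X} (hT : Continuous T) (hn : 0 < n)
    {J : Set (X × Y)} (hJ : IsJoining (T^[n]) S J) :
    IsJoining T (towerMap S n)
      ((fun q : (X × Y) × Set.Iio n => (T^[q.2.1] q.1.1, (q.1.2, q.2))) '' J ×ˢ univ) := by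
  obtain ⟨⟨p, hp⟩, hcl, hinv, hfst, hsnd⟩ := hJ
  refine ⟨⟨_, mem_image_of_mem _ (mk_mem_prod hp (mem_univ ⟨0, hn⟩))⟩, ?_, ?_, ?_, ?_⟩
  · refine ((hcl.isCompact.prod isCompact_univ).image ?_).isClosed
    refine continuous_prod_of_discrete_right.2 fun i => ?_
    exact ((hT.iterate i.1).comp continuous_fst).prodMk (by fun_prop)
  · rintro _ ⟨⟨⟨x, y⟩, i, hi⟩, ⟨hxy, -⟩, rfl⟩
    have hi' : i < n := hi
    rcases Nat.lt_or_ge (i + 1) n with h | h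
    · refine ⟨((x, y), ⟨i + 1, h⟩), ⟨hxy, mem_univ _⟩, ?_⟩
      simp only [towerMap_of_lt S y hi' h, iterate_succ_apply']
    · have h : i + 1 = n := by omega
      refine ⟨((T^[n] x, S y), ⟨0, hn⟩), ⟨hinv _ hxy, mem_univ _⟩, ?_⟩
      simp only [towerMap_of_eq S y hi' h, ← h, iterate_succ_apply', iterate_zero, id]
  · refine eq_univ_of_forall fun x => ?_
    obtain ⟨q, hq, rfl⟩ := hfst.symm ▸ mem_univ x
    exact ⟨_, ⟨(q, ⟨0, hn⟩), ⟨hq, mem_univ _⟩, rfl⟩, rfl⟩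
  · refine eq_univ_of_forall fun ⟨y, i⟩ => ?_
    obtain ⟨q, hq, rfl⟩ := hsnd.symm ▸ mem_univ y
    exact ⟨_, ⟨(q, i), ⟨hq, mem_univ _⟩, rfl⟩, rfl⟩

end Tower

theorem stmt_17 {X : Type} [MetricSpace X] [CompactSpace X] (T : X → X)
    (hTc : Continuous T) (hTs : Function.Surjective T) (hTtr : IsTransitiveSys T)
    (hdisj : ∀ 𝒴 : TDS, IsMinimalSys 𝒴.map → DisjointSys T 𝒴.map)
    (n : ℕ) (hn : 0 < n) :
    ∀ 𝒴 : TDS, IsMinimalSys 𝒴.map → DisjointSys (T^[n]) 𝒴.map := by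
  intro 𝒴 h𝒴 J hJ
  have hJ' := hdisj ⟨𝒴.carrier × Set.Iio n, towerMap 𝒴.map n, continuous_towerMap 𝒴.cont,
    surjective_towerMap 𝒴.surj⟩ (isMinimalSys_towerMap h𝒴) _ (hJ.tower hTc hn)
  refine eq_univ_of_forall fun ⟨x, y⟩ => ?_
  obtain ⟨⟨⟨x', y'⟩, i⟩, ⟨hq, -⟩, he⟩ := hJ'.symm ▸ mem_univ (x, (y, (⟨0, hn⟩ : Set.Iio n)))
  simp only [Prod.mk.injEq] at he
  obtain ⟨rfl, rfl, rfl⟩ := he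
  exact hq
end

section
/- Every m-set contains a translate of a dynamical syndetic set: if A ⊆ ℤ₊ is an m-set, then there exist a dynamical syndetic set B ⊆ ℤ₊ and k ∈ ℤ₊ such that {b + k : b ∈ B} ⊆ A. -/
open Set Function Filter Topology

def MSet (A : Set ℕ) : Prop :=
  ∃ 𝒴 : TDS, IsMinimalSys 𝒴.map ∧
    ∃ (y : 𝒴.carrier) (V : Set 𝒴.carrier),
      IsOpen V ∧ V.Nonempty ∧ {n : ℕ | 𝒴.map^[n] y ∈ V} ⊆ A

theorem stmt_18 (A : Set ℕ) (hA : MSet A) :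
    ∃ (B : Set ℕ) (k : ℕ), DynSyndetic B ∧ ∀ b ∈ B, b + k ∈ A := by
  obtain ⟨𝒴, hmin, y, V, hV, hne, hsub⟩ := hA
  obtain ⟨_, hk, k, rfl⟩ := (hmin y).inter_open_nonempty V hV hne
  refine ⟨{n : ℕ | 𝒴.map^[n] (𝒴.map^[k] y) ∈ V}, k,
    ⟨𝒴, hmin, 𝒴.map^[k] y, V, hV, hk, Subset.rfl⟩, fun b hb => hsub ?_⟩
  simpa only [mem_ofPred_eq, iterate_add_apply] using hb
end
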